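/- arXiv:2012.01500 — 5 statements merged into one kernel-verified Lean document; each statement's English description precedes it below -/
import Mathlib

section
/- Let R be a commutative domain with field of fractions K and let A be an associative unital R-algebra. Suppose that for all a, b, c in A such that a^2 = 0 and b*c = 0, one has b*a*c = 0. Then every idempotent of the ring of fractions R^{-1}A (realized as the base change K ⊗_R A, i.e. FractionRing R ⊗[R] A) is central. -/
open scoped TensorProduct

theorem aux_loc {R : Type*} [CommRing R] [IsDomain R]
    {A : Type*} [Ring A] [Algebra R A]
    (h : ∀ a b c : A, a ^ 2 = 0 → b * c = 0 → b * a * c = 0) :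
    ∀ a b c : FractionRing R ⊗[R] A, a * a = 0 → b * c = 0 → b * a * c = 0 := by
  intro a b c ha hbc
  let f : A →ₐ[R] FractionRing R ⊗[R] A := Algebra.TensorProduct.includeRight
  have hloc : IsLocalizedModule (nonZeroDivisors R) f.toLinearMap :=
    inferInstanceAs (IsLocalizedModule (nonZeroDivisors R)
      (TensorProduct.mk R (FractionRing R) A 1))
  have hs : ∀ z, ∃ (s : nonZeroDivisors R) (a : A), (s : R) • z = f a := by
    intro z
    obtain ⟨⟨a, s⟩, hz⟩ := IsLocalizedModule.surj (nonZeroDivisors R) f.toLinearMap z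
    exact ⟨s, a, hz⟩
  have h0 : ∀ a, f a = 0 → ∃ s : nonZeroDivisors R, (s : R) • a = 0 := by
    intro a h
    exact (IsLocalizedModule.eq_zero_iff (nonZeroDivisors R) f.toLinearMap).1 h
  have hi : ∀ (s : nonZeroDivisors R) z, (s : R) • z = (0 : FractionRing R ⊗[R] A) → z = 0 := by
    intro s z hz
    exact IsLocalizedModule.smul_injective f.toLinearMap s (by simpa [Submonoid.smul_def] using hz)
  obtain ⟨s, a', hsa⟩ := hs a
  obtain ⟨t, b', htb⟩ := hs b
  obtain ⟨u, c', huc⟩ := hs c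
  obtain ⟨v, hv⟩ := h0 (a' * a') (by
    rw [map_mul, ← hsa, smul_mul_smul_comm, ha, smul_zero])
  obtain ⟨w, hw⟩ := h0 (b' * c') (by
    rw [map_mul, ← htb, ← huc, smul_mul_smul_comm, hbc, smul_zero])
  have key := h ((v : R) • a') ((w : R) • b') c'
    (by rw [pow_two, smul_mul_assoc, mul_smul_comm, hv, smul_zero])
    (by rw [smul_mul_assoc, hw])
  have key2 := congrArg f key
  rw [map_mul, map_mul, map_smul, map_smul, ← hsa, ← htb, ← huc, map_zero] at key2
  simp only [smul_mul_assoc, mul_smul_comm] at key2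
  iterate 5 replace key2 := hi _ _ key2
  exact key2

/-- Let `R` be a commutative domain with field of fractions `K` and `A`
an `R`-algebra. If for all `a, b, c ∈ A` with `a² = 0` and `b*c = 0` we have `b*a*c = 0`,
then every idempotent of the ring of fractions `R⁻¹A = K ⊗[R] A` is central. -/
theorem stmt11 {R : Type*} [CommRing R] [IsDomain R]
    {A : Type*} [Ring A] [Algebra R A]
    (h : ∀ a b c : A, a ^ 2 = 0 → b * c = 0 → b * a * c = 0) :
    ∀ e : FractionRing R ⊗[R] A, e * e = e →
      ∀ x : FractionRing R ⊗[R] A, e * x = x * e := by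
  intro e he x
  have e1 : e * (1 - e) = 0 := by rw [mul_sub, he, mul_one, sub_self]
  have e2 : (1 - e) * e = 0 := by rw [sub_mul, he, one_mul, sub_self]
  have h1 := aux_loc h (e * x * (1 - e)) e (1 - e)
    (by rw [show e * x * (1 - e) * (e * x * (1 - e)) = e * x * ((1 - e) * e) * (x * (1 - e)) by
          noncomm_ring, e2]; simp) e1
  have h2 := aux_loc h ((1 - e) * x * e) (1 - e) e
    (by rw [show (1 - e) * x * e * ((1 - e) * x * e) = (1 - e) * x * (e * (1 - e)) * (x * e) by
          noncomm_ring, e1]; simp) e2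
  have e3 : (1 - e) * (1 - e) = 1 - e := by rw [sub_mul, e1, one_mul, sub_zero]
  have h3 : e * x * (1 - e) = 0 := by
    rw [← h1, show e * (e * x * (1 - e)) * (1 - e) = (e * e) * x * ((1 - e) * (1 - e)) by
      simp only [mul_assoc], he, e3]
  have h4 : (1 - e) * x * e = 0 := by
    rw [← h2, show (1 - e) * ((1 - e) * x * e) * e = ((1 - e) * (1 - e)) * x * (e * e) by
      simp only [mul_assoc], he, e3]
  rw [mul_sub, mul_one, sub_eq_zero] at h3
  rw [sub_mul, one_mul, sub_mul, sub_eq_zero] at h4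
  rw [h3, h4]
end

section
/- Let A be a semiprime ring and let S = {a ∈ A : for all b, c ∈ A, b*c = 0 implies b*a*c = 0}. If S contains every element x of A with x^2 = 0, then S contains every nilpotent element of A. -/
/-- A ring `A` is semiprime if every two-sided ideal `I` with `I² = 0` is zero. -/
def IsSemiprimeRing (A : Type*) [Ring A] : Prop :=
  ∀ I : TwoSidedIdeal A, (∀ x ∈ I, ∀ y ∈ I, x * y = 0) → I = ⊥

theorem semiprime_elem {A : Type*} [Ring A] (hA : IsSemiprimeRing A) (x : A)
    (hx : ∀ r, x * r * x = 0) : x = 0 := by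
  let J : TwoSidedIdeal A := TwoSidedIdeal.mk' {u | ∀ r, x * r * u = 0}
    (by simp) (by intro a b ha hb r; rw [mul_add, ha, hb, add_zero])
    (by intro a ha r; rw [mul_neg, ha, neg_zero])
    (by intro a b hb r; have := hb (r * a); simpa only [mul_assoc] using this)
    (by intro a b ha r; rw [← mul_assoc, ha, zero_mul])
  let I : TwoSidedIdeal A := TwoSidedIdeal.span {x}
  have hIJ : ∀ v ∈ I, ∀ r, x * r * v = 0 := by
    intro v hv
    have h1 : I ≤ J := TwoSidedIdeal.span_le.2 (by
      intro y hy
      rw [Set.mem_singleton_iff.1 hy]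
      exact (TwoSidedIdeal.mem_mk' _ _ _ _ _ _ _).2 hx)
    exact (TwoSidedIdeal.mem_mk' _ _ _ _ _ _ _).1 (h1 hv)
  let K : TwoSidedIdeal A := TwoSidedIdeal.mk' {u | ∀ v ∈ I, ∀ r, u * r * v = 0}
    (by simp) (by intro a b ha hb v hv r; rw [add_mul, add_mul, ha v hv, hb v hv, add_zero])
    (by intro a ha v hv r; rw [neg_mul, neg_mul, ha v hv, neg_zero])
    (by intro a b hb v hv r; rw [mul_assoc a, mul_assoc a, hb v hv, mul_zero])
    (by intro a b ha v hv r; rw [mul_assoc a, ha v hv])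
  have hIK : ∀ u ∈ I, ∀ v ∈ I, ∀ r, u * r * v = 0 := by
    intro u hu
    have h1 : I ≤ K := TwoSidedIdeal.span_le.2 (by
      intro y hy
      rw [Set.mem_singleton_iff.1 hy]
      exact (TwoSidedIdeal.mem_mk' _ _ _ _ _ _ _).2 hIJ)
    exact (TwoSidedIdeal.mem_mk' _ _ _ _ _ _ _).1 (h1 hu)
  have h0 : I = ⊥ := hA I (fun u hu v hv => by simpa using hIK u hu v hv 1)
  have hxI : x ∈ I := TwoSidedIdeal.subset_span (Set.mem_singleton x)
  rw [h0] at hxI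
  exact (TwoSidedIdeal.mem_bot A).1 hxI

/-- Let `A` be a semiprime ring and
`S = {a ∈ A : ∀ b c, b*c = 0 → b*a*c = 0}`. If `S` contains every square-zero element of
`A`, then `S` contains every nilpotent element of `A`. -/
theorem stmt12 {A : Type*} [Ring A] (hA : IsSemiprimeRing A)
    (hS : ∀ x : A, x ^ 2 = 0 → ∀ b c : A, b * c = 0 → b * x * c = 0) :
    ∀ a : A, IsNilpotent a → ∀ b c : A, b * c = 0 → b * a * c = 0 := by
  rintro a ⟨n, hn⟩
  induction n generalizing a with
  | zero =>
    intro b c _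
    have h1 : (1 : A) = 0 := by simpa using hn
    rw [← mul_one (b * a * c), h1, mul_zero]
  | succ n ih =>
    intro b c hbc
    rcases Nat.eq_zero_or_pos n with rfl | hpos
    · have : a = 0 := by simpa using hn
      simp [this]
    have h2 : b * a ^ 2 * c = 0 := by
      refine ih (a ^ 2) ?_ b c hbc
      rw [← pow_mul]
      exact pow_eq_zero_of_le (by omega) hn
    apply semiprime_elem hA
    intro r
    have ht : (a * c * r * b * a) ^ 2 = 0 := by
      have : (a * c * r * b * a) ^ 2 = a * c * r * (b * a ^ 2 * c) * r * b * a := by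
        noncomm_ring
      rw [this, h2]; simp
    have := hS _ ht b c hbc
    simpa only [mul_assoc] using this
end

section
/- Let K be a field of characteristic 0 and G any group. Then the group algebra K[G] is semiprime: every two-sided ideal I of K[G] with I^2 = 0 is zero. -/
open Cardinal

noncomputable def sst {G : Type*} [Group G] (a : MonoidAlgebra ℂ G) : MonoidAlgebra ℂ G :=
  MonoidAlgebra.ofCoeff ((a.coeff.mapRange (starRingEnd ℂ) (map_zero _)).equivMapDomain (Equiv.inv G))

theorem sst_coeff {G : Type*} [Group G] (a : MonoidAlgebra ℂ G) (g : G) :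
    (sst a).coeff g = starRingEnd ℂ (a.coeff g⁻¹) := by
  simp [sst]

theorem sst_add {G : Type*} [Group G] (a b : MonoidAlgebra ℂ G) :
    sst (a + b) = sst a + sst b := by
  ext g; simp [sst_coeff]

theorem sst_zero {G : Type*} [Group G] : sst (0 : MonoidAlgebra ℂ G) = 0 := by
  ext g; simp [sst_coeff]

theorem sst_sst {G : Type*} [Group G] (a : MonoidAlgebra ℂ G) : sst (sst a) = a := by
  ext g; simp [sst_coeff]

theorem sst_single {G : Type*} [Group G] (g : G) (r : ℂ) :
    sst (MonoidAlgebra.single g r) = MonoidAlgebra.single g⁻¹ (starRingEnd ℂ r) := by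
  classical
  ext h; simp [sst_coeff, Finsupp.single_apply, inv_eq_iff_eq_inv, apply_ite (starRingEnd ℂ), eq_inv_iff_mul_eq_one]
  

theorem sst_mul {G : Type*} [Group G] (a b : MonoidAlgebra ℂ G) :
    sst (a * b) = sst b * sst a := by
  induction a using MonoidAlgebra.induction_linear with
  | zero => simp [sst_zero]
  | add x y hx hy => simp [add_mul, mul_add, sst_add, hx, hy]
  | single g r =>
    induction b using MonoidAlgebra.induction_linear with
    | zero => simp [sst_zero]
    | add x y hx hy => simp [add_mul, mul_add, sst_add, hx, hy]
    | single h s => simp [sst_single, MonoidAlgebra.single_mul_single, mul_comm]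

theorem mul_sst_eq_zero {G : Type*} [Group G] (a : MonoidAlgebra ℂ G)
    (h : a * sst a = 0) : a = 0 := by
  have h1 : (a * sst a).coeff 1 = 0 := by rw [h]; simp
  rw [MonoidAlgebra.coeff_mul_apply_left] at h1
  have h2 : ∑ g ∈ a.coeff.support, Complex.normSq (a.coeff g) = 0 := by
    have : ((∑ g ∈ a.coeff.support, Complex.normSq (a.coeff g) : ℝ) : ℂ) = 0 := by
      rw [← h1, Finsupp.sum]
      push_cast
      refine Finset.sum_congr rfl fun g _ => ?_
      simp [sst_coeff, Complex.mul_conj]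
    exact_mod_cast this
  rw [Finset.sum_eq_zero_iff_of_nonneg (fun _ _ => Complex.normSq_nonneg _)] at h2
  ext g
  by_contra hg
  exact hg (by simpa using h2 g (by simpa using hg))

theorem complex_case {G : Type*} [Group G] (a : MonoidAlgebra ℂ G)
    (h : ∀ g : G, a * MonoidAlgebra.single g 1 * a = 0) : a = 0 := by
  have h1 : ∀ x, a * x * a = 0 := by
    intro x
    induction x using MonoidAlgebra.induction_linear with
    | zero => simp
    | add x y hx hy => simp [add_mul, mul_add, hx, hy]
    | single g r =>
      have : MonoidAlgebra.single g r = r • MonoidAlgebra.single g (1 : ℂ) := by simp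
      rw [this, mul_smul_comm, smul_mul_assoc, h, smul_zero]
  apply mul_sst_eq_zero
  apply mul_sst_eq_zero
  rw [sst_mul, sst_sst, ← mul_assoc, h1, zero_mul]

theorem exists_embed (F : Type*) [Field F] [CharZero F] [Countable F] : Nonempty (F →+* ℂ) := by
  let P := MvPolynomial ℝ F
  let Q := FractionRing P
  let E := AlgebraicClosure Q
  have hi : Function.Injective (algebraMap P E) := by
    rw [IsScalarTower.algebraMap_eq P Q E]
    exact (algebraMap Q E).injective.comp (IsFractionRing.injective P Q)
  let f : F →+* E := (algebraMap P E).comp MvPolynomial.C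
  have : CharZero E := charZero_of_injective_ringHom f.injective
  have hP : #P ≤ Cardinal.continuum := by
    refine MvPolynomial.cardinalMk_le_max_lift.trans ?_
    refine max_le (max_le ?_ ?_) Cardinal.aleph0_le_continuum
    · exact (by simp : Cardinal.lift #F ≤ Cardinal.aleph0).trans Cardinal.aleph0_le_continuum
    · simp [Cardinal.mk_real]
  have hQ : #Q ≤ Cardinal.continuum :=
    (IsLocalization.cardinalMk_le (nonZeroDivisors P)).trans hP
  have hE : #E ≤ Cardinal.continuum :=
    (Algebra.IsAlgebraic.cardinalMk_le_max Q E).trans (max_le hQ Cardinal.aleph0_le_continuum)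
  have hE' : Cardinal.continuum ≤ #E := by
    have := Cardinal.mk_le_of_injective ((hi.comp (MvPolynomial.X_injective)).comp ULift.down_injective)
    simpa [Cardinal.mk_real] using this
  have hE'' : #E = Cardinal.continuum := le_antisymm hE hE'
  obtain ⟨e⟩ := IsAlgClosed.ringEquiv_of_equiv_of_charZero (K := E) (L := ℂ)
    (by rw [hE'']; exact Cardinal.aleph0_lt_continuum)
    (Cardinal.lift_mk_eq'.1 (by rw [hE'', Cardinal.mk_complex]; simp))
  exact ⟨e.toRingHom.comp f⟩

theorem general_case {K : Type*} [Field K] [CharZero K] {G : Type*} [Group G] (a : MonoidAlgebra K G)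
    (h : ∀ g : G, a * MonoidAlgebra.single g 1 * a = 0) : a = 0 := by
  classical
  let F := Subfield.closure (a.coeff '' (a.coeff.support : Set G))
  have : Countable F := by
    rw [← Cardinal.mk_le_aleph0_iff]
    refine (Subfield.cardinalMk_closure_le_max _).trans ?_
    simp only [max_le_iff, le_refl, and_true]
    exact Cardinal.mk_le_aleph0_iff.2 ((a.coeff.support.finite_toSet.image _).countable.to_subtype)
  obtain ⟨φ⟩ := exists_embed F
  have hm : ∀ g, a.coeff g ∈ F := by
    intro g
    by_cases hg : a.coeff g = 0
    · rw [hg]; exact F.zero_mem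
    · exact Subfield.subset_closure ⟨g, by simpa using hg, rfl⟩
  let b : MonoidAlgebra F G := MonoidAlgebra.ofCoeff
    (Finsupp.onFinset a.coeff.support (fun g => (⟨a.coeff g, hm g⟩ : F)) (by
      intro g hg; simpa [Subtype.ext_iff] using hg))
  have hb : MonoidAlgebra.mapRingHom G F.subtype b = a := by
    ext g; simp [b]
  have hinj : Function.Injective (MonoidAlgebra.mapRingHom G F.subtype) := by
    intro x y hxy
    ext g
    have := congrArg (fun z => z.coeff g) hxy
    simpa using this
  have hinj' : Function.Injective (MonoidAlgebra.mapRingHom G φ) := by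
    intro x y hxy
    ext g
    have := congrArg (fun z => z.coeff g) hxy
    exact congrArg Subtype.val (φ.injective (by simpa only [MonoidAlgebra.coeff_mapRingHom] using this))
  have hbb : ∀ g : G, b * MonoidAlgebra.single g 1 * b = 0 := by
    intro g
    apply hinj
    simp [hb, h]
  have : b = 0 := by
    apply hinj'
    rw [map_zero]
    apply complex_case
    intro g
    have := congrArg (MonoidAlgebra.mapRingHom G φ) (hbb g)
    simpa using this
  rw [← hb, this, map_zero]

/-- Let `K` be a field of characteristic `0` and `G` any group. Then the
group algebra `K[G]` is semiprime: every two-sided ideal `I` of `K[G]` with `I² = 0` is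
zero. -/
theorem stmt15 {K : Type*} [Field K] [CharZero K] {G : Type*} [Group G] :
    ∀ I : TwoSidedIdeal (MonoidAlgebra K G),
      (∀ x ∈ I, ∀ y ∈ I, x * y = 0) → I = ⊥ := by
  intro I hI
  rw [eq_bot_iff]
  intro a ha
  rw [TwoSidedIdeal.mem_bot]
  exact general_case a fun g => hI _ (I.mul_mem_right _ _ ha) _ ha
end

section
/- Let R be an infinite commutative domain and n > 1 an integer. Then the group of units U(M_n(R)) = GL_n(R) of the matrix algebra M_n(R) does not satisfy any group identity: for every positive integer l and every nontrivial element w of the free group F_l, there exists an assignment u : Fin l → GL_n(R) such that the image of w under the induced group homomorphism F_l → GL_n(R) is not the identity matrix. -/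
open Polynomial in
/-- Descend along evaluation of polynomials. -/
theorem aux_descend {R : Type*} [CommRing R] [IsDomain R] [Infinite R] {l : ℕ}
    (w : FreeGroup (Fin l)) 
    (h : ∃ u : Fin l → (Matrix (Fin 2) (Fin 2) R[X])ˣ, FreeGroup.lift u w ≠ 1) :
    ∃ u : Fin l → (Matrix (Fin 2) (Fin 2) R)ˣ, FreeGroup.lift u w ≠ 1 := by
  obtain ⟨u, hu⟩ := h
  by_contra! hc
  apply hu
  apply Units.ext
  refine Matrix.ext fun i j => ?_
  apply Polynomial.funext
  intro r
  let φ : (Matrix (Fin 2) (Fin 2) R[X])ˣ →* (Matrix (Fin 2) (Fin 2) R)ˣ :=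
    Units.map ((Polynomial.evalRingHom r).mapMatrix : _ →+* _).toMonoidHom
  have h1 := hc (fun i => φ (u i))
  have h2 : FreeGroup.lift (fun i => φ (u i)) = φ.comp (FreeGroup.lift u) := by
    ext i; simp
  rw [h2] at h1
  have h3 := congrArg (fun m : (Matrix (Fin 2) (Fin 2) R)ˣ => m.val i j) h1
  simp only [MonoidHom.comp_apply, φ, Units.coe_map] at h3
  have h4 : ((1 : (Matrix (Fin 2) (Fin 2) R[X])ˣ).val i j).eval r = (1 : Matrix (Fin 2) (Fin 2) R) i j := by
    simp only [Units.val_one, Matrix.one_apply]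
    split_ifs <;> simp
  rw [h4]
  exact h3

def auxHom (m : ℕ) (R : Type*) [CommRing R] :
    Matrix (Fin 2) (Fin 2) R →* Matrix (Fin 2 ⊕ Fin m) (Fin 2 ⊕ Fin m) R where
  toFun A := Matrix.fromBlocks A 0 0 1
  map_one' := by simp
  map_mul' A B := by simp [Matrix.fromBlocks_multiply]

theorem aux_embed {R : Type*} [CommRing R] {n : ℕ} (hn : 1 < n) {l : ℕ}
    (w : FreeGroup (Fin l)) 
    (h : ∃ u : Fin l → (Matrix (Fin 2) (Fin 2) R)ˣ, FreeGroup.lift u w ≠ 1) :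
    ∃ u : Fin l → (Matrix (Fin n) (Fin n) R)ˣ, FreeGroup.lift u w ≠ 1 := by
  obtain ⟨m, rfl⟩ : ∃ m, n = 2 + m := ⟨n - 2, by omega⟩
  obtain ⟨u, hu⟩ := h
  let ψ : Matrix (Fin 2) (Fin 2) R →* Matrix (Fin (2 + m)) (Fin (2 + m)) R :=
    ((Matrix.reindexAlgEquiv R R (finSumFinEquiv (m := 2) (n := m))) : _ →* _).comp (auxHom m R)
  have hψ : Function.Injective ψ := by
    intro A B hAB
    have h1 : auxHom m R A = auxHom m R B :=
      (Matrix.reindexAlgEquiv R R (finSumFinEquiv (m := 2) (n := m))).injective hAB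
    exact (Matrix.fromBlocks_inj.1 h1).1
  refine ⟨fun i => Units.map ψ (u i), ?_⟩
  have h2 : FreeGroup.lift (fun i => Units.map ψ (u i)) = (Units.map ψ).comp (FreeGroup.lift u) := by
    ext i; simp
  rw [h2, MonoidHom.comp_apply]
  intro h
  exact hu (Units.map_injective hψ (h.trans (map_one _).symm))

open Polynomial

/-- column vector of a letter -/
def auxP {S : Type*} [CommRing S] (s : S) (e : Bool) : Fin 2 → S :=
  cond e ![1 + s ^ 2, s] ![s, 1]

/-- row vector of a letter -/
def auxQ {S : Type*} [CommRing S] (s : S) (e : Bool) : Fin 2 → S :=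
  cond e ![1, -s] ![-s, 1 + s ^ 2]

def auxC {S : Type*} [CommRing S] (s : S) (e : Bool) : Matrix (Fin 2) (Fin 2) S :=
  cond e !![-(s + s + s ^ 3), (1 + s ^ 2) ^ 2 + s ^ 2; -(1 + s ^ 2), s + s + s ^ 3]
   !![(s + s + s ^ 3), -((1 + s ^ 2) ^ 2 + s ^ 2); (1 + s ^ 2), -(s + s + s ^ 3)]

noncomputable def auxM {S : Type*} [CommRing S] (s : S) (e : Bool) : Matrix (Fin 2) (Fin 2) S[X] :=
  Matrix.of fun i j => X * C (auxP s e i * auxQ s e j) + C (auxC s e i j)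

theorem auxM_mul {S : Type*} [CommRing S] (s : S) (e : Bool) : auxM s e * auxM s (!e) = 1 := by
  refine Matrix.ext fun i j => ?_
  cases e <;> fin_cases i <;> fin_cases j <;>
    simp [auxM, auxP, auxQ, auxC, Matrix.mul_apply, Fin.sum_univ_two] <;> ring

noncomputable def auxU {S : Type*} [CommRing S] (s : S) : (Matrix (Fin 2) (Fin 2) S[X])ˣ :=
  ⟨auxM s true, auxM s false, auxM_mul s true, auxM_mul s false⟩

theorem aux_step {S : Type*} [CommRing S] (s : S) (e : Bool) (x : Fin 2 → S[X]) (k : ℕ)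
    (c : S) (P : Fin 2 → S) (hd : ∀ j, (x j).natDegree ≤ k) (hc : ∀ j, (x j).coeff k = c * P j)
    (i : Fin 2) :
    (((auxM s e).mulVec x) i).natDegree ≤ k + 1 ∧
    (((auxM s e).mulVec x) i).coeff (k + 1) =
      (c * (auxQ s e 0 * P 0 + auxQ s e 1 * P 1)) * auxP s e i := by
  have key : ∀ a b : S, ∀ j, ((X * C a + C b) * x j).natDegree ≤ k + 1 ∧
      ((X * C a + C b) * x j).coeff (k + 1) = a * (c * P j) := by
    intro a b j
    constructor
    · refine natDegree_mul_le.trans ?_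
      have h1 : (X * C a + C b : S[X]).natDegree ≤ 1 := by compute_degree
      have := hd j
      omega
    · rw [add_mul, coeff_add, mul_assoc, coeff_X_mul, coeff_C_mul, coeff_C_mul, hc,
        coeff_eq_zero_of_natDegree_lt (Nat.lt_succ_of_le (hd j))]
      ring
  simp only [Matrix.mulVec, dotProduct, Fin.sum_univ_two, auxM, Matrix.of_apply]
  refine ⟨natDegree_add_le_of_degree_le (key _ _ 0).1 (key _ _ 1).1, ?_⟩
  rw [coeff_add, (key _ _ 0).2, (key _ _ 1).2]
  ring

theorem aux_word {S : Type*} [CommRing S] [IsDomain S] {ι : Type*} (s : ι → S)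
    (hs : ∀ a b : ι × Bool, (a.1 = b.1 → a.2 = b.2) →
      auxQ (s a.1) a.2 0 * auxP (s b.1) b.2 0 + auxQ (s a.1) a.2 1 * auxP (s b.1) b.2 1 ≠ 0)
    (L : List (ι × Bool)) : ∀ a, FreeGroup.IsReduced (a :: L) →
      ∃ v : Fin 2 → S, ∃ c : S, c ≠ 0 ∧ ∀ j,
        ((((a :: L).map fun b => auxM (s b.1) b.2).prod.mulVec (fun j => C (v j))) j).natDegree
          ≤ L.length + 1 ∧
        ((((a :: L).map fun b => auxM (s b.1) b.2).prod.mulVec (fun j => C (v j))) j).coeff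
          (L.length + 1) = c * auxP (s a.1) a.2 j := by
  induction L with
  | nil =>
    intro a _
    refine ⟨auxP (s a.1) a.2, _, mul_ne_zero one_ne_zero (hs a a (fun _ => rfl)), fun j => ?_⟩
    simp only [List.map_cons, List.map_nil, List.prod_cons, List.prod_nil, mul_one,
      List.length_nil]
    exact aux_step (s a.1) a.2 _ 0 1 _ (by simp) (by simp) j
  | cons b L ih =>
    intro a ha
    unfold FreeGroup.IsReduced at ha ih
    rw [List.isChain_cons_cons] at ha
    obtain ⟨v, c, hc, h⟩ := ih b ha.2
    refine ⟨v, _, mul_ne_zero hc (hs a b ha.1), fun j => ?_⟩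
    rw [List.map_cons, List.prod_cons, ← Matrix.mulVec_mulVec]
    exact aux_step (s a.1) a.2 _ _ c _ (fun j => (h j).1) (fun j => (h j).2) j

theorem auxP_ne {S : Type*} [CommRing S] [IsDomain S] (s : S) (e : Bool) : ∃ j, auxP s e j ≠ 0 := by
  by_contra! h
  have h0 := h 0
  have h1 := h 1
  cases e
  · simp [auxP] at h1
  · simp [auxP] at h0 h1
    simp [h1] at h0

theorem aux_free {S : Type*} [CommRing S] [IsDomain S] {ι : Type*} (s : ι → S)
    (hs : ∀ a b : ι × Bool, (a.1 = b.1 → a.2 = b.2) →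
      auxQ (s a.1) a.2 0 * auxP (s b.1) b.2 0 + auxQ (s a.1) a.2 1 * auxP (s b.1) b.2 1 ≠ 0)
    (w : FreeGroup ι) (hw : w ≠ 1) : FreeGroup.lift (fun i => auxU (s i)) w ≠ 1 := by
  classical
  intro h
  have hred : FreeGroup.IsReduced w.toWord := FreeGroup.isReduced_toWord
  have hne : w.toWord ≠ [] := fun h => hw (FreeGroup.toWord_eq_nil_iff.1 h)
  rw [← FreeGroup.mk_toWord (x := w), FreeGroup.lift_mk] at h
  generalize w.toWord = L at *
  have h' := congrArg (Units.coeHom _) h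
  rw [map_list_prod, List.map_map, map_one] at h'
  have e : (⇑(Units.coeHom (Matrix (Fin 2) (Fin 2) S[X])) ∘ fun x : ι × Bool =>
      bif x.2 then auxU (s x.1) else (auxU (s x.1))⁻¹) = fun b => auxM (s b.1) b.2 := by
    funext ⟨i, b⟩
    cases b <;> rfl
  rw [e] at h'
  cases L with
  | nil => exact hne rfl
  | cons a L =>
    obtain ⟨v, c, hc, H⟩ := aux_word s hs L a hred
    obtain ⟨j, hj⟩ := auxP_ne (s a.1) a.2
    have := (H j).2
    rw [h', Matrix.one_mulVec, coeff_C_succ] at this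
    exact mul_ne_zero hc hj this.symm

theorem aux_s {R : Type*} [CommRing R] [IsDomain R] {l : ℕ} (a b : Fin l × Bool)
    (h : a.1 = b.1 → a.2 = b.2) :
    auxQ (X ^ (a.1.val + 1) : R[X]) a.2 0 * auxP (X ^ (b.1.val + 1) : R[X]) b.2 0 +
      auxQ (X ^ (a.1.val + 1) : R[X]) a.2 1 * auxP (X ^ (b.1.val + 1) : R[X]) b.2 1 ≠ 0 := by
  obtain ⟨i, e⟩ := a
  obtain ⟨j, f⟩ := b
  have hX : i ≠ j → (X ^ (j.val + 1) - X ^ (i.val + 1) : R[X]) ≠ 0 := by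
    intro hij h0
    have := congrArg natDegree (sub_eq_zero.1 h0)
    simp only [natDegree_X_pow] at this
    exact hij (Fin.ext (by omega))
  cases e <;> cases f <;> simp only [auxQ, auxP, cond_true, cond_false, Matrix.cons_val_zero,
    Matrix.cons_val_one] at h ⊢
  · intro h0
    have := congrArg (eval 0) h0
    simp at this
  · have hij : i ≠ j := fun hh => by simpa using h hh
    have h1 : (1 - X ^ (i.val + 1) * X ^ (j.val + 1) : R[X]) ≠ 0 := by
      intro h0
      have := congrArg (eval 0) h0
      simp at this
    have := mul_ne_zero (hX hij) h1
    intro h0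
    apply this
    rw [← h0]
    ring
  · have hij : i ≠ j := fun hh => by simpa using h hh
    intro h0
    apply hX hij
    rw [← h0]
    ring
  · intro h0
    have := congrArg (eval 0) h0
    simp at this

/-- Let `R` be an infinite commutative domain and `n > 1`. Then the
group of units `GLₙ(R)` of the matrix algebra `Mₙ(R)` does not satisfy any group identity:
for every `l > 0` and every nontrivial word `w` in the free group on `l` generators there
is an assignment of the variables to invertible matrices not sending `w` to `1`. -/
theorem stmt16 {R : Type*} [CommRing R] [IsDomain R] [Infinite R]
    {n : ℕ} (hn : 1 < n) :
    ∀ l : ℕ, 0 < l → ∀ w : FreeGroup (Fin l), w ≠ 1 →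
      ∃ u : Fin l → (Matrix (Fin n) (Fin n) R)ˣ, FreeGroup.lift u w ≠ 1 := by
  intro l _ w hw
  refine aux_embed hn w (aux_descend w (aux_descend w ⟨_, aux_free (fun i : Fin l => (Polynomial.X ^ (i.val + 1) : Polynomial R)) aux_s w hw⟩))
end

section
/- Let R be a commutative ring and n a positive integer. The group of units U(M_n(R)) = GL_n(R) of the matrix algebra M_n(R) satisfies the Laurent polynomial identity S_{2n}(x_1,...,x_{2n})·(x_1 x_2 ··· x_{2n})^{-1}: for all invertible matrices u_1,...,u_{2n} in GL_n(R), one has (Σ_{σ ∈ Sym(2n)} sgn(σ) u_{σ(1)}···u_{σ(2n)}) · (u_1 u_2 ··· u_{2n})^{-1} = 0 in M_n(R). -/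
open Polynomial in
theorem AL.deriv_det {C : Type*} [CommRing C] {n : ℕ} (M : Matrix (Fin n) (Fin n) C) :
    derivative M.charpoly = (M.charmatrix.adjugate).trace := by
  rw [Matrix.charpoly, ← Matrix.det_transpose, Matrix.det_apply, map_sum]
  simp only [Matrix.trace, Matrix.diag, Matrix.adjugate_apply]
  simp only [← Matrix.det_transpose (Matrix.updateRow _ _ _)]
  simp only [Matrix.det_apply]
  rw [Finset.sum_comm]
  refine Finset.sum_congr rfl fun σ _ => ?_
  rw [← Finset.smul_sum, Units.smul_def, Units.smul_def, map_zsmul, derivative_prod_finset]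
  congr 1
  refine Finset.sum_congr rfl fun i _ => ?_
  rw [← Finset.mul_prod_erase _ _ (Finset.mem_univ i), mul_comm]
  congr 1
  · by_cases h : σ i = i
    · simp [h]
    · simp [h, Matrix.charmatrix_apply_ne M i (σ i) (Ne.symm h)]
  · refine Finset.prod_congr rfl fun j hj => ?_
    have := Finset.ne_of_mem_erase hj
    simp [Matrix.updateRow_apply, this]

open Polynomial in
theorem AL.newton {S : Type*} [CommRing S] {n : ℕ} (M : Matrix (Fin n) (Fin n) S)
    (hC : ∀ k : ℕ, k ≠ 0 → IsUnit (k : S))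
    (hM : ∀ k : ℕ, (M ^ (k + 1)).trace = 0) : M ^ n = 0 := by
  rcases Nat.eq_zero_or_pos n with rfl | hn
  · exact Subsingleton.elim _ _
  set Q := matPolyEquiv M.charmatrix.adjugate with hQ
  have hmul : (X - C M) * Q = M.charpoly.map (algebraMap _ _) := by
    rw [hQ, ← Matrix.matPolyEquiv_charmatrix, ← map_mul, Matrix.mul_adjugate,
      ← Matrix.charpoly, matPolyEquiv_smul_one]
  have hrec : ∀ k, Q.coeff k = M * Q.coeff (k+1) + M.charpoly.coeff (k+1) • 1 := by
    intro k
    have := congrArg (fun p => p.coeff (k+1)) hmul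
    simp only [sub_mul, coeff_sub, coeff_X_mul, coeff_C_mul, coeff_map,
      Algebra.algebraMap_eq_smul_one] at this
    rw [← this]; abel
  have h0 : - (M * Q.coeff 0) = M.charpoly.coeff 0 • 1 := by
    have := congrArg (fun p => p.coeff 0) hmul
    simpa [sub_mul, coeff_sub, coeff_C_mul, coeff_map,
      Algebra.algebraMap_eq_smul_one] using this
  have htr : ∀ d k j, Q.natDegree < k + d → (M ^ (j+1) * Q.coeff k).trace = 0 := by
    intro d
    induction d with
    | zero => 
      intro k j h
      rw [coeff_eq_zero_of_natDegree_lt (by simpa using h)]; simp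
    | succ d ih =>
      intro k j h
      rw [hrec, mul_add, ← mul_assoc, ← pow_succ, Matrix.trace_add, ih (k+1) (j+1) (by omega)]
      simp [hM]
  have htr' : ∀ k j, (M ^ (j+1) * Q.coeff k).trace = 0 := fun k j =>
    htr (Q.natDegree + 1) k j (by omega)
  have hc : ∀ k, k < n → M.charpoly.coeff k = 0 := by
    intro k hk
    rcases k with _ | k
    · have h1 := congrArg Matrix.trace h0
      have h2 := htr' 0 0
      rw [zero_add, pow_one] at h2
      rw [Matrix.trace_neg, h2, Matrix.trace_smul, Matrix.trace_one, Fintype.card_fin, neg_zero,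
        smul_eq_mul] at h1
      exact ((hC n hn.ne').mul_left_eq_zero).1 h1.symm
    · have h1 := congrArg Matrix.trace (hrec k)
      have h2 := htr' (k+1) 0
      rw [zero_add, pow_one] at h2
      rw [Matrix.trace_add, h2, Matrix.trace_smul, Matrix.trace_one, Fintype.card_fin, zero_add,
        smul_eq_mul] at h1
      have h3 : (Q.coeff k).trace = M.charpoly.coeff (k+1) * (k+1) := by
        rw [← coeff_derivative, AL.deriv_det]
        simp [Matrix.trace, hQ, matPolyEquiv_coeff_apply]
      rw [h3] at h1
      have h4 : M.charpoly.coeff (k+1) * ((n - (k+1) : ℕ) : S) = 0 := by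
        rw [Nat.cast_sub hk.le]; push_cast; rw [mul_sub, h1, sub_self]
      exact ((hC _ (by omega)).mul_left_eq_zero).1 h4
  rcases subsingleton_or_nontrivial S with _ | _
  · exact Subsingleton.elim _ _
  have hX : M.charpoly = X ^ n := by
    ext k
    rw [coeff_X_pow]
    have hd := M.charpoly_natDegree_eq_dim
    rw [Fintype.card_fin] at hd
    rcases lt_trichotomy k n with h | h | h
    · rw [hc k h, if_neg h.ne]
    · rw [if_pos h]
      have := M.charpoly_monic
      rw [Monic, leadingCoeff, hd] at this
      rw [h]; exact this
    · rw [if_neg h.ne', coeff_eq_zero_of_natDegree_lt (by omega)]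
  have := M.aeval_self_charpoly
  simpa [hX] using this

theorem AL.nil {K V : Type*} [CommRing K] [AddCommGroup V] [Module K V] {n : ℕ}
    (hK : ∀ k : ℕ, k ≠ 0 → IsUnit (k : K)) (v : Matrix (Fin n) (Fin n) V) :
    (v.map (ExteriorAlgebra.ι K)) ^ (2 * n) = 0 := by
  set A := v.map (ExteriorAlgebra.ι K) with hA
  have anti : ∀ x y : V, ExteriorAlgebra.ι K x * ExteriorAlgebra.ι K y =
      - (ExteriorAlgebra.ι K y * ExteriorAlgebra.ι K x) := fun x y =>
    eq_neg_of_add_eq_zero_left (ExteriorAlgebra.ι_add_mul_swap x y)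
  let s : Set (ExteriorAlgebra K V) :=
    {x | ∃ u w, x = ExteriorAlgebra.ι K u * ExteriorAlgebra.ι K w}
  have comm1 : ∀ x ∈ s, ∀ w, ExteriorAlgebra.ι K w * x = x * ExteriorAlgebra.ι K w := by
    rintro _ ⟨a, b, rfl⟩ w
    rw [← mul_assoc, anti w a, neg_mul, mul_assoc, anti w b, mul_neg, neg_neg, mul_assoc]
  have hcomm : ∀ a ∈ s, ∀ b ∈ s, a * b = b * a := by
    rintro _ ⟨a, b, rfl⟩ y hy
    rw [mul_assoc, comm1 y hy, ← mul_assoc, comm1 y hy, mul_assoc]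
  let E := Algebra.adjoin K s
  letI : CommRing E := Algebra.adjoinCommRingOfComm K hcomm
  have comm2 : ∀ x ∈ E, ∀ w, ExteriorAlgebra.ι K w * x = x * ExteriorAlgebra.ι K w := by
    intro x hx w
    induction hx using Algebra.adjoin_induction with
    | mem x hx => exact comm1 x hx w
    | algebraMap r => exact (Algebra.commutes r _).symm
    | add x y _ _ h1 h2 => rw [mul_add, add_mul, h1, h2]
    | mul x y _ _ h1 h2 => rw [← mul_assoc, h1, mul_assoc, h2, mul_assoc]
  let B : Matrix (Fin n) (Fin n) E := Matrix.of fun p q =>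
    ∑ r, ⟨ExteriorAlgebra.ι K (v p r) * ExteriorAlgebra.ι K (v r q),
      Algebra.subset_adjoin ⟨_, _, rfl⟩⟩
  let f : E →+* ExteriorAlgebra K V := E.val.toRingHom
  have hf : ∀ x : E, f x = x := fun _ => rfl
  have hB : f.mapMatrix B = A * A := by
    ext p q
    simp [B, hA, Matrix.mul_apply, hf]
  have hBk : ∀ k, f.mapMatrix (B ^ k) = (A * A) ^ k := fun k => by rw [map_pow, hB]
  have hfi : Function.Injective f := Subtype.val_injective
  have hunit : ∀ k : ℕ, k ≠ 0 → IsUnit (k : E) := by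
    intro k hk
    have := (hK k hk).map (algebraMap K E)
    rwa [map_natCast] at this
  have hunit' : IsUnit ((2 : ℕ) : ExteriorAlgebra K V) := by
    have := (hK 2 (by norm_num)).map (algebraMap K (ExteriorAlgebra K V))
    rwa [map_natCast] at this
  have htr : ∀ k : ℕ, (B ^ (k + 1)).trace = 0 := by
    intro k
    apply hfi
    have e1 : f (B ^ (k+1)).trace = ((A * A) ^ (k+1)).trace := by
      rw [← hBk]; simp [Matrix.trace]
    rw [e1, map_zero]
    have e2 : (A * (A * A) ^ k * A).trace = - (A * A * (A * A) ^ k).trace := by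
      rw [← hBk]
      simp only [Matrix.trace, Matrix.diag, Matrix.mul_apply, Finset.sum_mul]
      rw [← Finset.sum_neg_distrib]
      simp only [← Finset.sum_neg_distrib]
      rw [Finset.sum_comm]
      refine Finset.sum_congr rfl fun q _ => ?_
      rw [Finset.sum_comm]
      refine Finset.sum_congr rfl fun r _ => ?_
      refine Finset.sum_congr rfl fun p _ => ?_
      have hc := comm2 (f.mapMatrix (B ^ k) r q) ((B ^ k) r q).2
      simp only [hA, Matrix.map_apply] at hc ⊢
      rw [hc, mul_assoc, anti (v p r), mul_neg, mul_assoc (ExteriorAlgebra.ι K (v q p)), hc,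
        ← mul_assoc, ← mul_assoc, hc]
    have e3 : A * (A * A) ^ k * A = A * A * (A * A) ^ k := by
      have : Commute A ((A * A) ^ k) := ((Commute.refl A).mul_right (Commute.refl A)).pow_right k
      rw [mul_assoc, ← this.eq, mul_assoc]
    rw [e3] at e2
    rw [pow_succ']
    have e4 : ((2:ℕ) : ExteriorAlgebra K V) * (A * A * (A * A) ^ k).trace = 0 := by
      rw [Nat.cast_ofNat, two_mul]
      exact eq_neg_iff_add_eq_zero.1 e2
    exact hunit'.mul_right_eq_zero.1 e4
  have := AL.newton B hunit htr
  rw [pow_mul, pow_two, ← hBk, this, map_zero]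

theorem AL.phi (K : Type*) [CommRing K] (m : ℕ) :
    ∃ φ : ExteriorAlgebra K (Fin m → K) →ₗ[K] K, ∀ w : Fin m → Fin m → K,
      φ (ExteriorAlgebra.ιMulti K m w) = Matrix.det (Matrix.of w) := by
  let F : ∀ i, (Fin m → K) [⋀^Fin i]→ₗ[K] K := Function.update 0 m Matrix.detRowAlternating
  refine ⟨ExteriorAlgebra.liftAlternating F, fun w => ?_⟩
  rw [ExteriorAlgebra.liftAlternating_apply_ιMulti]
  simp only [F, Function.update_self]
  rfl

theorem AL.char0 {K : Type*} [CommRing K] {n : ℕ}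
    (hK : ∀ k : ℕ, k ≠ 0 → IsUnit (k : K)) (a : Fin (2 * n) → Matrix (Fin n) (Fin n) K) :
    ∑ σ : Equiv.Perm (Fin (2 * n)), (Equiv.Perm.sign σ : ℤ) •
      (List.ofFn (fun i : Fin (2 * n) => a (σ i))).prod = 0 := by
  let e : Fin (2 * n) → (Fin (2 * n) → K) := fun i => Pi.single i 1
  let v : Matrix (Fin n) (Fin n) (Fin (2 * n) → K) := Matrix.of fun p q i => a i p q
  let g : Matrix (Fin n) (Fin n) K →+* Matrix (Fin n) (Fin n) (ExteriorAlgebra K (Fin (2 * n) → K)) := (algebraMap K (ExteriorAlgebra K (Fin (2 * n) → K))).mapMatrix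
  let sc : (ExteriorAlgebra K (Fin (2 * n) → K)) →+* Matrix (Fin n) (Fin n) (ExteriorAlgebra K (Fin (2 * n) → K)) := Matrix.scalar (Fin n)
  have hcomm : ∀ x M, Commute (sc x) (g M) := by
    intro x M
    apply Matrix.ext
    intro p q
    simp [sc, g, Algebra.commutes]
  have hA : v.map (ExteriorAlgebra.ι K) =
      ∑ i, sc (ExteriorAlgebra.ι K (e i)) * g (a i) := by
    ext p q
    have : v p q = ∑ i, a i p q • e i := by
      ext j
      simp [v, e, Finset.sum_apply, Pi.single_apply]
    rw [Matrix.map_apply, this, map_sum, Matrix.sum_apply]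
    refine Finset.sum_congr rfl fun i _ => ?_
    rw [map_smul, Algebra.smul_def, Algebra.commutes]
    simp [sc, g]
  have hprod : ∀ (k : ℕ) (r : Fin k → Fin (2 * n)),
      (List.ofFn fun i => sc (ExteriorAlgebra.ι K (e (r i))) * g (a (r i))).prod =
      sc (ExteriorAlgebra.ιMulti K k (e ∘ r)) * g (List.ofFn fun i => a (r i)).prod := by
    intro k r
    induction k with
    | zero => simp
    | succ k ih =>
      rw [List.ofFn_succ, List.prod_cons, ih (fun i => r i.succ), List.ofFn_succ, List.prod_cons,
        ExteriorAlgebra.ιMulti_succ_apply, map_mul, map_mul]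
      have h := (hcomm (ExteriorAlgebra.ιMulti K k (e ∘ fun i => r i.succ)) (a (r 0))).eq
      have h2 : Matrix.vecTail (e ∘ r) = e ∘ fun i => r i.succ := rfl
      rw [h2, mul_assoc, ← mul_assoc (g _) (sc _), ← h]
      simp only [mul_assoc, Function.comp]
  have hpow : ∑ r : Fin (2 * n) → Fin (2 * n),
      sc (ExteriorAlgebra.ιMulti K (2 * n) (e ∘ r)) * g (List.ofFn fun i => a (r i)).prod = 0 := by
    have h := AL.nil hK v
    rw [hA] at h
    have h2 := (MultilinearMap.mkPiAlgebraFin ℤ (2 * n) (Matrix (Fin n) (Fin n) (ExteriorAlgebra K (Fin (2 * n) → K)))).map_sum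
      (fun (_ : Fin (2 * n)) i => sc (ExteriorAlgebra.ι K (e i)) * g (a i))
    simp only [MultilinearMap.mkPiAlgebraFin_apply, List.ofFn_const, List.prod_replicate] at h2
    rw [h] at h2
    rw [h2]
    exact Finset.sum_congr rfl fun r _ => (hprod _ r).symm
  obtain ⟨φ, hφ⟩ := AL.phi K (2 * n)
  have hsum : ∑ r : Fin (2 * n) → Fin (2 * n),
      Matrix.det (Matrix.of (e ∘ r)) • (List.ofFn fun i => a (r i)).prod = 0 := by
    ext p q
    have h := congrArg φ (congrFun (congrFun hpow p) q)
    rw [Matrix.sum_apply, map_sum] at h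
    rw [Matrix.sum_apply]
    refine Eq.trans (Finset.sum_congr rfl fun r _ => ?_) (h.trans (by simp))
    have : (sc (ExteriorAlgebra.ιMulti K (2 * n) (e ∘ r)) * g (List.ofFn fun i => a (r i)).prod) p q
       = (List.ofFn fun i => a (r i)).prod p q • ExteriorAlgebra.ιMulti K (2 * n) (e ∘ r) := by
      simp [sc, g, Algebra.smul_def, Algebra.commutes]
    rw [this, map_smul, hφ, Matrix.smul_apply, smul_eq_mul, smul_eq_mul, mul_comm]
  rw [← hsum]
  have hinj : Function.Injective
      (fun (σ : Equiv.Perm (Fin (2 * n))) => (σ : Fin (2 * n) → Fin (2 * n))) :=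
    DFunLike.coe_injective
  symm
  rw [← Finset.sum_subset (Finset.subset_univ (Finset.univ.map ⟨_, hinj⟩)), Finset.sum_map]
  · refine Finset.sum_congr rfl fun σ _ => ?_
    have : Matrix.det (Matrix.of (e ∘ σ)) = ((Equiv.Perm.sign σ : ℤ) : K) := by
      have h1 : Matrix.of (e ∘ σ) = (1 : Matrix _ _ K).submatrix σ id := by
        ext i j
        simp [e, Matrix.one_apply, Pi.single_apply, eq_comm]
      rw [h1, Matrix.det_permute]
      simp
    simp only [Function.Embedding.coeFn_mk]
    rw [this, Int.cast_smul_eq_zsmul]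
  · intro r _ hr
    have : ¬ Function.Injective r := by
      intro h
      apply hr
      simp only [Finset.mem_map, Finset.mem_univ, true_and]
      exact ⟨Equiv.ofBijective r (Finite.injective_iff_bijective.1 h), rfl⟩
    simp only [Function.Injective, not_forall] at this
    obtain ⟨i, j, hij, hne⟩ := this
    rw [Matrix.det_zero_of_row_eq hne (by ext; simp [hij]), zero_smul]

theorem AL.map_std {R S : Type*} [CommRing R] [CommRing S] (f : R →+* S) {n : ℕ}
    (a : Fin (2 * n) → Matrix (Fin n) (Fin n) R) :
    f.mapMatrix (∑ σ : Equiv.Perm (Fin (2 * n)), (Equiv.Perm.sign σ : ℤ) •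
      (List.ofFn (fun i : Fin (2 * n) => a (σ i))).prod) =
    ∑ σ : Equiv.Perm (Fin (2 * n)), (Equiv.Perm.sign σ : ℤ) •
      (List.ofFn (fun i : Fin (2 * n) => f.mapMatrix (a (σ i)))).prod := by
  rw [map_sum]
  refine Finset.sum_congr rfl fun σ _ => ?_
  rw [map_zsmul, map_list_prod, List.map_ofFn]
  rfl

theorem AL.main {R : Type*} [CommRing R] {n : ℕ} (a : Fin (2 * n) → Matrix (Fin n) (Fin n) R) :
    ∑ σ : Equiv.Perm (Fin (2 * n)), (Equiv.Perm.sign σ : ℤ) •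
      (List.ofFn (fun i : Fin (2 * n) => a (σ i))).prod = 0 := by
  let I := Fin (2 * n) × Fin n × Fin n
  let x : Fin (2 * n) → Matrix (Fin n) (Fin n) (MvPolynomial I ℤ) := fun k =>
    Matrix.of fun i j => MvPolynomial.X (k, i, j)
  let f : MvPolynomial I ℤ →+* R :=
    MvPolynomial.eval₂Hom (Int.castRingHom R) (fun t => a t.1 t.2.1 t.2.2)
  let g : MvPolynomial I ℤ →+* MvPolynomial I ℚ := MvPolynomial.map (Int.castRingHom ℚ)
  have hg : Function.Injective g := MvPolynomial.map_injective _ Int.cast_injective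
  have hx : ∑ σ : Equiv.Perm (Fin (2 * n)), (Equiv.Perm.sign σ : ℤ) •
      (List.ofFn (fun i : Fin (2 * n) => x (σ i))).prod = 0 := by
    have h := AL.map_std g x
    rw [AL.char0 (K := MvPolynomial I ℚ) ?_ (fun i => g.mapMatrix (x i))] at h
    · apply Matrix.map_injective hg
      beta_reduce
      rw [Matrix.map_zero _ (map_zero g)]
      exact h
    · intro k hk
      have : IsUnit (k : ℚ) := (Nat.cast_ne_zero.2 hk).isUnit
      have := this.map (MvPolynomial.C (σ := I))
      rwa [map_natCast] at this
  have h := AL.map_std f x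
  rw [hx, map_zero] at h
  rw [h]
  have : ∀ i, f.mapMatrix (x i) = a i := by
    intro i
    ext p q
    simp [f, x]
  simp only [this]



/-- Let `R` be a commutative ring and `n` a positive integer. The group
of units `GLₙ(R)` of the matrix algebra `Mₙ(R)` satisfies the Laurent polynomial identity
`S₂ₙ(x₁,...,x₂ₙ)·(x₁x₂⋯x₂ₙ)⁻¹`: for all invertible matrices `u₁,...,u₂ₙ`,
`(Σ_{σ} sgn(σ) u_{σ(1)}⋯u_{σ(2n)}) · (u₁u₂⋯u₂ₙ)⁻¹ = 0` in `Mₙ(R)`. -/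
theorem stmt17 {R : Type*} [CommRing R] {n : ℕ} (hn : 0 < n) :
    ∀ u : Fin (2 * n) → (Matrix (Fin n) (Fin n) R)ˣ,
      (∑ σ : Equiv.Perm (Fin (2 * n)),
          (Equiv.Perm.sign σ : ℤ) •
            (List.ofFn (fun i : Fin (2 * n) => (u (σ i) : Matrix (Fin n) (Fin n) R))).prod) *
        ((((List.ofFn (fun i : Fin (2 * n) => u i)).prod)⁻¹ : (Matrix (Fin n) (Fin n) R)ˣ) :
          Matrix (Fin n) (Fin n) R) = 0 := by
  intro u
  rw [AL.main (fun i => (u i : Matrix (Fin n) (Fin n) R)), zero_mul]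
end
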